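/- Let μ be the Bernoulli measure on {a,b}^ℕ with μ(a) = p and μ(b) = 1−p, 0 < p < 1, and let f be the run-length encoder. Then for μ⊗μ-almost every pair of sequences (x,y), lim_{n→∞} M^RLE_n(x,y)/log n = 4 / log( (1+p)(2−p) / (p(1−p)) ). -/

import Mathlib

open MeasureTheory Filter Topology

section RLEDefs

variable {A : Type*}

/-- The starting position of the run following the run that starts at position `i`:
the least index `> i` where the value of `x` changes (with the junk convention `i + 1`
if the sequence is constant from position `i` on). -/
noncomputable def nextChange (x : ℕ → A) (i : ℕ) : ℕ := by
  classical
  exact if h : ∃ j, x (i + j + 1) ≠ x i then i + Nat.find h + 1 else i + 1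

/-- Starting position of the `n`-th maximal run of the sequence `x`. -/
noncomputable def runStart (x : ℕ → A) : ℕ → ℕ
  | 0 => 0
  | n + 1 => nextChange x (runStart x n)

/-- The run-length encoder `f : A^ℕ → (A × ℕ)^ℕ`: the `n`-th symbol of `f x` is the pair
(value of the `n`-th maximal run of `x`, length of that run). -/
noncomputable def rle (x : ℕ → A) (n : ℕ) : A × ℕ :=
  (x (runStart x n), runStart x (n + 1) - runStart x n)

/-- `M_n(u,v)`: the length of the longest common substring of `u` and `v`
occurring within their first `n` symbols, i.e.
`max {k : u_i^{i+k-1} = v_j^{j+k-1} for some 0 ≤ i,j ≤ n-k}`. -/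
noncomputable def matchLen {C : Type*} (u v : ℕ → C) (n : ℕ) : ℕ :=
  sSup {k | ∃ i j, i + k ≤ n ∧ j + k ≤ n ∧ ∀ m < k, u (i + m) = v (j + m)}

/-- `M^RLE_n(x,y) = M_n(f x, f y)`. -/
noncomputable def MRLE (x y : ℕ → A) (n : ℕ) : ℕ := matchLen (rle x) (rle y) n

/-- `M̃_n(x,y) = max {k : f(σ^i x)_1^k = f(σ^j y)_1^k for some 0 ≤ i,j ≤ n-k}`. -/
noncomputable def Mtilde (x y : ℕ → A) (n : ℕ) : ℕ :=
  sSup {k | ∃ i j, i + k ≤ n ∧ j + k ≤ n ∧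
    ∀ m < k, rle (fun t => x (t + i)) m = rle (fun t => y (t + j)) m}

/-- The number of maximal runs in the first `n` symbols of `x`, i.e. `|f(x_1^n)|`. -/
noncomputable def runCount (x : ℕ → A) (n : ℕ) : ℕ := by
  classical
  exact ((Finset.range n).filter fun i => i = 0 ∨ x i ≠ x (i - 1)).card

/-- The left shift `σ` on sequences. -/
def shift (x : ℕ → A) : ℕ → A := fun n => x (n + 1)

variable [MeasurableSpace A]

/-- `Σ_{ω ∈ B^n} (f_*μ)(ω)²`: the sum, over all cylinders `ω` of length `n` in
`B^ℕ = (A × ℕ)^ℕ`, of the squared measure of `f⁻¹ω` (where `f` is the run-length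
encoder), i.e. of the squared pushforward measure of the cylinder. -/
noncomputable def pushCylSum (μ : Measure (ℕ → A)) (n : ℕ) : ℝ :=
  ∑' ω : Fin n → A × ℕ, ((μ {x | ∀ i : Fin n, rle x i = ω i}).toReal) ^ 2

/-- Lower Rényi entropy of order 2 of the pushforward measure `f_*μ`:
`H̲₂(f_*μ) = - liminf_n (1/n) log Σ_ω (f_*μ)(ω)²`. -/
noncomputable def H2lower (μ : Measure (ℕ → A)) : ℝ :=
  -liminf (fun n : ℕ => Real.log (pushCylSum μ n) / n) atTop

/-- Upper Rényi entropy of order 2 of the pushforward measure `f_*μ`: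
`H̄₂(f_*μ) = - limsup_n (1/n) log Σ_ω (f_*μ)(ω)²`. -/
noncomputable def H2upper (μ : Measure (ℕ → A)) : ℝ :=
  -limsup (fun n : ℕ => Real.log (pushCylSum μ n) / n) atTop

/-- Hypothesis (A): there are `c > 0`, `h > 0` with `μ(a…a) ≤ c e^{-hn}` for every
constant cylinder `a…a` of length `n`. -/
def HypA (μ : Measure (ℕ → A)) (c h : ℝ) : Prop :=
  0 < c ∧ 0 < h ∧
    ∀ (n : ℕ) (a : A), μ {x | ∀ i < n, x i = a} ≤ ENNReal.ofReal (c * Real.exp (-h * n))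

/-- The σ-algebra `F_0^n` generated by the coordinates `X_0, …, X_n`. -/
def cylAlgLE (A : Type*) [MeasurableSpace A] (n : ℕ) : MeasurableSpace (ℕ → A) :=
  MeasurableSpace.comap (fun x (i : Fin (n + 1)) => x i) inferInstance

/-- The σ-algebra `F_m^∞` generated by the coordinates `X_m, X_{m+1}, …`. -/
def cylAlgGE (A : Type*) [MeasurableSpace A] (m : ℕ) : MeasurableSpace (ℕ → A) :=
  MeasurableSpace.comap (fun x (i : ℕ) => x (m + i)) inferInstance

/-- α-mixing with rate function `a`: for all `n, g` and all `S ∈ F_0^n`, `T ∈ F_{n+g}^∞`,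
`|μ(S ∩ T) - μ(S)μ(T)| ≤ a(g)`. -/
def AlphaMixingBound (μ : Measure (ℕ → A)) (a : ℕ → ℝ) : Prop :=
  ∀ (n g : ℕ) (S T : Set (ℕ → A)),
    MeasurableSet[cylAlgLE A n] S → MeasurableSet[cylAlgGE A (n + g)] T →
    |(μ (S ∩ T)).toReal - (μ S).toReal * (μ T).toReal| ≤ a g

/-- α-mixing with exponential decay. -/
def AlphaMixingExp (μ : Measure (ℕ → A)) : Prop :=
  ∃ C θ : ℝ, 0 < C ∧ 0 < θ ∧ AlphaMixingBound μ fun g => C * Real.exp (-θ * g)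

/-- ψ-mixing with polynomial rate `ψ(g) = g^{-a}`: for all `n` and `g ≥ 1` and all
`S ∈ F_0^n`, `T ∈ F_{n+g}^∞`, `|μ(S ∩ T) - μ(S)μ(T)| ≤ g^{-a} μ(S) μ(T)`. -/
def PsiMixingPoly (μ : Measure (ℕ → A)) (a : ℝ) : Prop :=
  ∀ (n g : ℕ), 1 ≤ g → ∀ (S T : Set (ℕ → A)),
    MeasurableSet[cylAlgLE A n] S → MeasurableSet[cylAlgGE A (n + g)] T →
    |(μ (S ∩ T)).toReal - (μ S).toReal * (μ T).toReal| ≤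
      (g : ℝ) ^ (-a) * (μ S).toReal * (μ T).toReal

/-- `S_n = Σ_{0 ≤ i,j ≤ n-1} 1_{A_{i,j}}` with `A_{i,j} = {f(σ^i X)_1^k = f(σ^j Y)_1^k}`,
seen as a random variable on the product space (X = first coordinate, Y = second). -/
noncomputable def Sn (k n : ℕ) (p : (ℕ → A) × (ℕ → A)) : ℝ := by
  classical
  exact ∑ i ∈ Finset.range n, ∑ j ∈ Finset.range n,
    if ∀ m < k, rle (fun t => p.1 (t + i)) m = rle (fun t => p.2 (t + j)) m then (1 : ℝ) else 0

end RLEDefs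

open scoped ENNReal

theorem aux_second_moment {Ω ι : Type*} [MeasurableSpace Ω] (P : Measure Ω) [IsProbabilityMeasure P]
    (s : Finset ι) (E : ι → Set Ω) (hE : ∀ i, MeasurableSet (E i)) :
    P.real {ω | ∀ i ∈ s, ω ∉ E i} * (∑ i ∈ s, P.real (E i)) ^ 2 ≤
      (∑ i ∈ s, ∑ j ∈ s, P.real (E i ∩ E j)) - (∑ i ∈ s, P.real (E i)) ^ 2 := by
  classical
  set m := ∑ i ∈ s, P.real (E i) with hm
  let S : Ω → ℝ := fun ω => ∑ i ∈ s, (E i).indicator (fun _ => (1:ℝ)) ω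
  have hint : ∀ i, Integrable ((E i).indicator (fun _ => (1:ℝ))) P := fun i =>
    (integrable_const (1:ℝ)).indicator (hE i)
  have hint2 : ∀ i j, Integrable ((E i ∩ E j).indicator (fun _ => (1:ℝ))) P := fun i j =>
    (integrable_const (1:ℝ)).indicator ((hE i).inter (hE j))
  have hSint : Integrable S P := integrable_finsetSum _ fun i _ => hint i
  have hS : ∫ ω, S ω ∂P = m := by
    simp only [S]
    rw [integral_finsetSum _ fun i _ => hint i]
    simp [hm, integral_indicator_const, hE]
  have hS2' : ∀ ω, S ω ^ 2 = ∑ i ∈ s, ∑ j ∈ s, (E i ∩ E j).indicator (fun _ => (1:ℝ)) ω := by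
    intro ω
    simp only [S, sq, Finset.sum_mul_sum]
    refine Finset.sum_congr rfl fun i _ => Finset.sum_congr rfl fun j _ => ?_
    by_cases h1 : ω ∈ E i <;> by_cases h2 : ω ∈ E j <;> simp [Set.indicator, h1, h2]
  have hS2int : Integrable (fun ω => S ω ^ 2) P := by
    simp only [hS2']
    exact integrable_finsetSum _ fun i _ => integrable_finsetSum _ fun j _ => hint2 i j
  have hS2 : ∫ ω, S ω ^ 2 ∂P = ∑ i ∈ s, ∑ j ∈ s, P.real (E i ∩ E j) := by
    simp only [hS2']
    rw [integral_finsetSum _ fun i _ => integrable_finsetSum _ fun j _ => hint2 i j]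
    refine Finset.sum_congr rfl fun i _ => ?_
    rw [integral_finsetSum _ fun j _ => hint2 i j]
    refine Finset.sum_congr rfl fun j _ => ?_
    rw [integral_indicator_const _ ((hE i).inter (hE j))]; simp
  have hA : MeasurableSet {ω | ∀ i ∈ s, ω ∉ E i} := by
    have : {ω | ∀ i ∈ s, ω ∉ E i} = ⋂ i ∈ s, (E i)ᶜ := by ext; simp
    rw [this]
    exact Finset.measurableSet_biInter _ fun i _ => (hE i).compl
  have key : ∫ ω, ({ω | ∀ i ∈ s, ω ∉ E i} : Set Ω).indicator (fun _ => m ^ 2) ω ∂P ≤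
      ∫ ω, (S ω ^ 2 - 2 * m * S ω + m ^ 2) ∂P := by
    refine integral_mono ((integrable_const _).indicator hA)
      ((hS2int.sub (hSint.const_mul _)).add (integrable_const _)) ?_
    intro ω
    by_cases h : ω ∈ {ω | ∀ i ∈ s, ω ∉ E i}
    · have : S ω = 0 := by
        refine Finset.sum_eq_zero fun i hi => ?_
        simp [h i hi]
      simp [Set.indicator_of_mem h, this]
    · simp only [Set.indicator_of_notMem h]
      nlinarith [sq_nonneg (S ω - m)]
  have h10 : ∫ ω, (S ω ^ 2 - 2 * m * S ω + m ^ 2) ∂P =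
      (∑ i ∈ s, ∑ j ∈ s, P.real (E i ∩ E j)) - 2 * m * m + m ^ 2 := by
    have e1 : Integrable (fun ω => S ω ^ 2 - 2 * m * S ω) P := hS2int.sub (hSint.const_mul _)
    rw [integral_add e1 (integrable_const _),
      integral_sub hS2int (hSint.const_mul _), integral_const_mul, hS, hS2]
    simp
  rw [integral_indicator_const _ hA, h10, smul_eq_mul] at key
  linarith [key]

section matching
variable {Ω₁ Ω₂ W : Type*} [MeasurableSpace Ω₁] [MeasurableSpace Ω₂] [Countable W] [MeasurableSpace W]
  [MeasurableSingletonClass W]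

theorem aux_match_meas (P₁ : Measure Ω₁) [IsProbabilityMeasure P₁] (P₂ : Measure Ω₂)
    [IsProbabilityMeasure P₂]
    (U : Ω₁ → W) (V : Ω₂ → W) (hU : Measurable U) (hV : Measurable V) (p q : W → ℝ≥0∞)
    (h1 : ∀ w, P₁ {x | U x = w} = p w) (h2 : ∀ w, P₂ {y | V y = w} = q w) :
    (P₁.prod P₂) {z | U z.1 = V z.2} = ∑' w, p w * q w := by
  have hm : MeasurableSet {z : Ω₁ × Ω₂ | U z.1 = V z.2} :=
    measurableSet_eq_fun (hU.comp measurable_fst) (hV.comp measurable_snd)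
  rw [Measure.prod_apply hm]
  have : ∀ x, P₂ (Prod.mk x ⁻¹' {z : Ω₁ × Ω₂ | U z.1 = V z.2}) = q (U x) := by
    intro x
    rw [← h2]
    congr 1
    ext y; simp [eq_comm]
  simp only [this]
  rw [← lintegral_map (f := q) (measurable_of_countable _) hU, lintegral_countable']
  refine tsum_congr fun w => ?_
  rw [Measure.map_apply hU (measurableSet_singleton w), mul_comm, ← h1]
  rfl

theorem aux_matching (P₁ : Measure Ω₁) [IsProbabilityMeasure P₁] (P₂ : Measure Ω₂)
    [IsProbabilityMeasure P₂]
    (U : ℕ → Ω₁ → W) (V : ℕ → Ω₂ → W) (hU : ∀ s, Measurable (U s)) (hV : ∀ s, Measurable (V s))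
    (p : W → ℝ≥0∞)
    (h1 : ∀ s w, P₁ {x | U s x = w} = p w) (h2 : ∀ s w, P₂ {y | V s y = w} = p w)
    (h11 : ∀ s s', s ≠ s' → ∀ w w', P₁ {x | U s x = w ∧ U s' x = w'} = p w * p w')
    (h22 : ∀ s s', s ≠ s' → ∀ w w', P₂ {x | V s x = w ∧ V s' x = w'} = p w * p w')
    (σ : ℝ) (hσ : 0 < σ) (hs : ∑' w, p w * p w = ENNReal.ofReal (σ ^ 2)) (N : ℕ) (hN : 0 < N) :
    (P₁.prod P₂).real {z | ∀ s < N, ∀ t < N, U s z.1 ≠ V t z.2} ≤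
      2 / (N * σ) + 1 / (N * σ) ^ 2 := by
  classical
  set Q := P₁.prod P₂ with hQ
  let E : ℕ × ℕ → Set (Ω₁ × Ω₂) := fun a => {z | U a.1 z.1 = V a.2 z.2}
  have hE : ∀ a, MeasurableSet (E a) := fun a =>
    measurableSet_eq_fun ((hU _).comp measurable_fst) ((hV _).comp measurable_snd)
  have hple : ∀ w, p w ≤ ENNReal.ofReal σ := by
    intro w
    by_contra! hc
    have h3 : p w * p w ≤ ENNReal.ofReal (σ ^ 2) := hs ▸ ENNReal.le_tsum w
    have h4 : ENNReal.ofReal σ * ENNReal.ofReal σ < p w * p w := ENNReal.mul_lt_mul hc hc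
    rw [← ENNReal.ofReal_mul hσ.le, ← sq] at h4
    exact absurd h3 (not_le.mpr h4)
  have hEm : ∀ a, Q (E a) = ENNReal.ofReal (σ ^ 2) := fun a => by
    rw [← hs]
    exact aux_match_meas P₁ P₂ _ _ (hU _) (hV _) p p (h1 _) (h2 _)
  have hEr : ∀ a, Q.real (E a) = σ ^ 2 := fun a => by
    rw [Measure.real, hEm, ENNReal.toReal_ofReal (by positivity)]
  have hcube : ∑' w, p w * (p w * p w) ≤ ENNReal.ofReal (σ ^ 3) := by
    calc ∑' w, p w * (p w * p w) ≤ ∑' w, ENNReal.ofReal σ * (p w * p w) :=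
          ENNReal.tsum_le_tsum fun w => mul_le_mul_left (hple w) _
      _ = ENNReal.ofReal (σ ^ 3) := by
          rw [ENNReal.tsum_mul_left, hs, ← ENNReal.ofReal_mul hσ.le]; congr 1; ring
  -- four cases
  have c1 : ∀ a b : ℕ × ℕ, a.1 ≠ b.1 → a.2 ≠ b.2 → Q.real (E a ∩ E b) = σ ^ 4 := by
    intro a b hab hab'
    have := aux_match_meas P₁ P₂ (fun x => (U a.1 x, U b.1 x)) (fun x => (V a.2 x, V b.2 x))
      ((hU _).prodMk (hU _)) ((hV _).prodMk (hV _)) (fun w => p w.1 * p w.2) (fun w => p w.1 * p w.2)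
      (fun w => by rw [← h11 _ _ hab]; congr 1; ext; simp [Prod.ext_iff])
      (fun w => by rw [← h22 _ _ hab']; congr 1; ext; simp [Prod.ext_iff])
    have h5 : E a ∩ E b = {z | (U a.1 z.1, U b.1 z.1) = (V a.2 z.2, V b.2 z.2)} := by
      ext z; simp [E]
    rw [Measure.real, h5, this, ENNReal.tsum_prod']
    have : ∑' (a : W) (b : W), p a * p b * (p a * p b) = ∑' (a : W) (b : W), (p a * p a) * (p b * p b) := by
      refine tsum_congr fun x => tsum_congr fun y => by ring
    simp only
    rw [this]
    simp_rw [ENNReal.tsum_mul_left, ENNReal.tsum_mul_right, hs]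
    rw [← ENNReal.ofReal_mul (by positivity), ENNReal.toReal_ofReal (by positivity)]; ring
  have c2 : ∀ a b : ℕ × ℕ, a.1 = b.1 → a.2 ≠ b.2 → Q.real (E a ∩ E b) ≤ σ ^ 3 := by
    intro a b hab hab'
    have := aux_match_meas P₁ P₂ (fun x => (U a.1 x, U a.1 x)) (fun x => (V a.2 x, V b.2 x))
      ((hU _).prodMk (hU _)) ((hV _).prodMk (hV _))
      (fun w => if w.1 = w.2 then p w.1 else 0) (fun w => p w.1 * p w.2)
      (fun w => by
        split_ifs with h
        · rw [← h1 a.1]; congr 1; ext; simp [Prod.ext_iff, h]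
        · convert measure_empty (μ := P₁)
          ext x
          simp only [Prod.ext_iff, Set.mem_ofPred_eq, Set.mem_empty_iff_false, iff_false]
          rintro ⟨h6, h7⟩; exact h (h6 ▸ h7))
      (fun w => by rw [← h22 _ _ hab']; congr 1; ext; simp [Prod.ext_iff])
    have h5 : E a ∩ E b = {z | (U a.1 z.1, U a.1 z.1) = (V a.2 z.2, V b.2 z.2)} := by
      ext z; simp [E, hab]
    rw [Measure.real, h5, this, ENNReal.tsum_prod']
    refine ENNReal.toReal_le_of_le_ofReal (by positivity) (le_trans (le_of_eq ?_) hcube)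
    refine tsum_congr fun x => ?_
    rw [tsum_eq_single x]
    · simp
    · intro y hy; simp [hy.symm]
  have c3 : ∀ a b : ℕ × ℕ, a.1 ≠ b.1 → a.2 = b.2 → Q.real (E a ∩ E b) ≤ σ ^ 3 := by
    intro a b hab hab'
    have := aux_match_meas P₁ P₂ (fun x => (U a.1 x, U b.1 x)) (fun x => (V a.2 x, V a.2 x))
      ((hU _).prodMk (hU _)) ((hV _).prodMk (hV _))
      (fun w => p w.1 * p w.2) (fun w => if w.1 = w.2 then p w.1 else 0)
      (fun w => by rw [← h11 _ _ hab]; congr 1; ext; simp [Prod.ext_iff])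
      (fun w => by
        split_ifs with h
        · rw [← h2 a.2]; congr 1; ext; simp [Prod.ext_iff, h]
        · convert measure_empty (μ := P₂)
          ext x
          simp only [Prod.ext_iff, Set.mem_ofPred_eq, Set.mem_empty_iff_false, iff_false]
          rintro ⟨h6, h7⟩; exact h (h6 ▸ h7))
    have h5 : E a ∩ E b = {z | (U a.1 z.1, U b.1 z.1) = (V a.2 z.2, V a.2 z.2)} := by
      ext z; simp [E, hab']
    rw [Measure.real, h5, this, ENNReal.tsum_prod']
    refine ENNReal.toReal_le_of_le_ofReal (by positivity) (le_trans (le_of_eq ?_) hcube)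
    refine tsum_congr fun x => ?_
    rw [tsum_eq_single x]
    · simp [mul_assoc]
    · intro y hy; simp [hy.symm]
  have call : ∀ a b : ℕ × ℕ, Q.real (E a ∩ E b) ≤ σ ^ 4 + (if b.1 = a.1 then σ ^ 3 else 0) +
      (if b.2 = a.2 then σ ^ 3 else 0) + (if b = a then σ ^ 2 else 0) := by
    intro a b
    by_cases ha : a.1 = b.1 <;> by_cases hb : a.2 = b.2
    · have : b = a := by ext <;> simp [ha, hb]
      subst this
      simp [hEr]; positivity
    · have h7 : b ≠ a := fun h => hb (by rw [h])
      have := c2 a b ha hb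
      simp [ha.symm, Ne.symm hb, h7]
      nlinarith [pow_pos hσ 4]
    · have h7 : b ≠ a := fun h => ha (by rw [h])
      have := c3 a b ha hb
      simp [Ne.symm ha, hb.symm, h7]
      nlinarith [pow_pos hσ 4]
    · have h7 : b ≠ a := fun h => ha (by rw [h])
      have := c1 a b ha hb
      simp [Ne.symm ha, Ne.symm hb, h7]
      linarith
  have hsm := aux_second_moment Q (Finset.range N ×ˢ Finset.range N) E hE
  have hset : {ω | ∀ i ∈ Finset.range N ×ˢ Finset.range N, ω ∉ E i} =
      {z | ∀ s < N, ∀ t < N, U s z.1 ≠ V t z.2} := by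
    ext z
    simp only [Set.mem_ofPred_eq, Finset.mem_product, Finset.mem_range, E]
    constructor
    · intro h s hs t ht; exact h (s, t) ⟨hs, ht⟩
    · intro h i hi; exact h _ hi.1 _ hi.2
  rw [hset] at hsm
  have hsum1 : ∑ i ∈ Finset.range N ×ˢ Finset.range N, Q.real (E i) = N ^ 2 * σ ^ 2 := by
    simp only [hEr, Finset.sum_const, Finset.card_product, Finset.card_range, nsmul_eq_mul]
    push_cast; ring
  have hsum2 : ∑ i ∈ Finset.range N ×ˢ Finset.range N, ∑ j ∈ Finset.range N ×ˢ Finset.range N,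
      Q.real (E i ∩ E j) ≤ N ^ 4 * σ ^ 4 + 2 * N ^ 3 * σ ^ 3 + N ^ 2 * σ ^ 2 := by
    calc _ ≤ ∑ i ∈ Finset.range N ×ˢ Finset.range N, (N ^ 2 * σ ^ 4 + N * σ ^ 3 + N * σ ^ 3 + σ ^ 2) := by
          refine Finset.sum_le_sum fun i hi => ?_
          refine (Finset.sum_le_sum fun j _ => call i j).trans (le_of_eq ?_)
          rw [Finset.mem_product] at hi
          simp only [Finset.sum_add_distrib]
          congr 1
          · congr 1
            · congr 1
              · simp only [Finset.sum_const, Finset.card_product, Finset.card_range, nsmul_eq_mul]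
                push_cast; ring
              · rw [Finset.sum_product_right]
                simp only [Finset.sum_ite_eq', hi.1, if_true, Finset.sum_const, Finset.card_range, nsmul_eq_mul]
            · rw [Finset.sum_product]
              simp only [Finset.sum_ite_eq', hi.2, if_true, Finset.sum_const, Finset.card_range, nsmul_eq_mul]
          · rw [Finset.sum_ite_eq']; simp [Finset.mem_range.mp hi.1, Finset.mem_range.mp hi.2]
      _ = _ := by
          simp only [Finset.sum_const, Finset.card_product, Finset.card_range, nsmul_eq_mul]
          push_cast; ring
  rw [hsum1] at hsm
  have hNr : (0:ℝ) < N := by exact_mod_cast hN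
  set B := Q.real {z | ∀ s < N, ∀ t < N, U s z.1 ≠ V t z.2}
  have h8 : B * (N ^ 2 * σ ^ 2) ^ 2 ≤ 2 * N ^ 3 * σ ^ 3 + N ^ 2 * σ ^ 2 := by nlinarith
  have h9 : 2 / (N * σ) + 1 / (N * σ) ^ 2 = (2 * N ^ 3 * σ ^ 3 + N ^ 2 * σ ^ 2) / ((N:ℝ) ^ 2 * σ ^ 2) ^ 2 := by
    field_simp
  rw [h9, le_div_iff₀ (by positivity)]
  exact h8

end matching
/-- The letter of the `i`-th run when the first letter is `c`. -/
def auxPar (c : Bool) (i : ℕ) : Bool := xor c i.bodd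

theorem auxPar_add (c : Bool) (i m : ℕ) : auxPar c (i + m) = auxPar (auxPar c i) m := by
  simp [auxPar, Nat.bodd_add]

/-- The encoded sequence with first letter `c` and run lengths `u`. -/
def auxEnc (c : Bool) (u : ℕ → ℕ) (n : ℕ) : Bool × ℕ := (auxPar c n, u n)

/-- Blocks of length `K` starting at `i`. -/
def auxBlk (K i : ℕ) (u : ℕ → ℕ) : Fin K → ℕ := fun m => u (i + m)

theorem auxBlk_meas (K i : ℕ) : Measurable (auxBlk K i) := by
  unfold auxBlk; fun_prop

theorem aux_tsum_pi (n : ℕ) (f : Fin n → ℕ → ℝ≥0∞) :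
    ∑' w : Fin n → ℕ, ∏ m, f m (w m) = ∏ m, ∑' t, f m t := by
  induction n with
  | zero => simp
  | succ n ih =>
    rw [← (Fin.consEquiv (fun _ : Fin (n+1) => ℕ)).tsum_eq, ENNReal.tsum_prod', Fin.prod_univ_succ,
      ← ih, ← ENNReal.tsum_mul_right]
    refine tsum_congr fun a => ?_
    rw [← ENNReal.tsum_mul_left]
    refine tsum_congr fun b => ?_
    simp [Fin.prod_univ_succ, Fin.consEquiv]

section blocks
variable (γ : Bool → Measure ℕ) [∀ b, IsProbabilityMeasure (γ b)]

/-- Product law of run lengths. -/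
noncomputable def auxNu (c : Bool) : Measure (ℕ → ℕ) :=
  Measure.infinitePi (fun i => γ (auxPar c i))

instance (c : Bool) : IsProbabilityMeasure (auxNu γ c) := by
  unfold auxNu; infer_instance

/-- Mass of a block. -/
noncomputable def auxP (a : Bool) (K : ℕ) (w : Fin K → ℕ) : ℝ≥0∞ :=
  ∏ m : Fin K, γ (auxPar a m) {w m}

theorem auxNu_finset (c : Bool) (s : Finset ℕ) (w : ℕ → ℕ) :
    auxNu γ c {u | ∀ i ∈ s, u i = w i} = ∏ i ∈ s, γ (auxPar c i) {w i} := by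
  unfold auxNu
  rw [← Measure.infinitePi_pi (μ := fun i => γ (auxPar c i)) (t := fun i => {w i})
    (fun i _ => measurableSet_singleton _)]
  congr 1

theorem auxNu_box (c : Bool) (i K : ℕ) (w : ℕ → ℕ) :
    auxNu γ c {u | ∀ m < K, u (i + m) = w (i + m)} =
      ∏ m ∈ Finset.range K, γ (auxPar (auxPar c i) m) {w (i + m)} := by
  have := auxNu_finset γ c ((Finset.range K).map (addLeftEmbedding i)) w
  simp only [Finset.mem_map, Finset.mem_range, Finset.prod_map, addLeftEmbedding_apply,
    auxPar_add, forall_exists_index, and_imp, forall_apply_eq_imp_iff₂] at this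
  exact this

theorem auxNu_blk (c : Bool) (i K : ℕ) (w : Fin K → ℕ) :
    auxNu γ c {u | auxBlk K i u = w} = auxP γ (auxPar c i) K w := by
  have := auxNu_box γ c i K (fun n => if h : n - i < K then w ⟨n - i, h⟩ else 0)
  unfold auxP
  rw [Finset.prod_range] at this
  simp only [Nat.add_sub_cancel_left, Fin.is_lt, dite_true, Fin.eta] at this
  rw [← this]
  congr 1
  ext u
  simp only [auxBlk, Set.mem_ofPred_eq, funext_iff, Fin.forall_iff]
  refine forall_congr' fun m => forall_congr' fun hm => ?_
  simp [hm]

theorem auxNu_blk2 (c : Bool) (i i' K : ℕ) (h : i + K ≤ i') (w w' : Fin K → ℕ) :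
    auxNu γ c {u | auxBlk K i u = w ∧ auxBlk K i' u = w'} =
      auxP γ (auxPar c i) K w * auxP γ (auxPar c i') K w' := by
  let W : ℕ → ℕ := fun n => if n < i' then (if h : n - i < K then w ⟨n - i, h⟩ else 0)
    else (if h : n - i' < K then w' ⟨n - i', h⟩ else 0)
  have hd : Disjoint ((Finset.range K).map (addLeftEmbedding i))
      ((Finset.range K).map (addLeftEmbedding i')) := by
    rw [Finset.disjoint_left]
    intro a ha hb
    simp only [Finset.mem_map, Finset.mem_range, addLeftEmbedding_apply] at ha hb
    omega
  have := auxNu_finset γ c (((Finset.range K).map (addLeftEmbedding i)).disjUnion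
      ((Finset.range K).map (addLeftEmbedding i')) hd) W
  rw [Finset.prod_disjUnion] at this
  simp only [Finset.mem_disjUnion, Finset.mem_map, Finset.mem_range, Finset.prod_map,
    addLeftEmbedding_apply, auxPar_add] at this
  have e1 : ∏ m ∈ Finset.range K, γ (auxPar (auxPar c i) m) {W (i + m)} = auxP γ (auxPar c i) K w := by
    rw [Finset.prod_range]
    refine Finset.prod_congr rfl fun m _ => ?_
    have : i + (m:ℕ) < i' := by omega
    simp [W, this]
  have e2 : ∏ m ∈ Finset.range K, γ (auxPar (auxPar c i') m) {W (i' + m)} =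
      auxP γ (auxPar c i') K w' := by
    rw [Finset.prod_range]
    refine Finset.prod_congr rfl fun m _ => ?_
    simp [W]
  rw [e1, e2] at this
  rw [← this]
  congr 1
  ext u
  simp only [auxBlk, Set.mem_ofPred_eq, funext_iff, Fin.forall_iff]
  constructor
  · rintro ⟨h1, h2⟩ n (⟨m, hm, rfl⟩ | ⟨m, hm, rfl⟩)
    · have : i + m < i' := by omega
      simp [W, this, hm, h1 m hm]
    · simp [W, hm, h2 m hm]
  · intro h3
    constructor
    · intro m hm
      have : i + m < i' := by omega
      rw [h3 _ (Or.inl ⟨m, hm, rfl⟩)]; simp [W, this, hm]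
    · intro m hm
      rw [h3 _ (Or.inr ⟨m, hm, rfl⟩)]; simp [W, hm]

theorem auxP_sq (a : Bool) (k : ℕ) (ρ : ℝ) (hρ : 0 < ρ)
    (hR : (∑' t, γ true {t} * γ true {t}) * (∑' t, γ false {t} * γ false {t}) = ENNReal.ofReal ρ) :
    ∑' w, auxP γ a (2 * k) w * auxP γ a (2 * k) w = ENNReal.ofReal (ρ ^ k) := by
  unfold auxP
  simp_rw [← Finset.prod_mul_distrib]
  rw [aux_tsum_pi (2 * k) (fun m t => γ (auxPar a m) {t} * γ (auxPar a m) {t})]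
  rw [Finset.prod_fin_eq_prod_range, ]
  have : ∀ k, ∏ i ∈ Finset.range (2 * k), (∑' t, γ (auxPar a i) {t} * γ (auxPar a i) {t}) =
      ENNReal.ofReal (ρ ^ k) := by
    intro k
    induction k with
    | zero => simp
    | succ k ih =>
      rw [show 2 * (k + 1) = 2 * k + 1 + 1 by ring, Finset.prod_range_succ, Finset.prod_range_succ, ih,
        pow_succ, ENNReal.ofReal_mul (by positivity), ← hR, mul_assoc]
      congr 1
      cases a <;> simp [auxPar, mul_comm]
  rw [← this k]
  refine Finset.prod_congr rfl fun i hi => ?_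
  rw [dif_pos (Finset.mem_range.mp hi)]

theorem auxEnc_match {c d : Bool} {u v : ℕ → ℕ} {i j K : ℕ} (hK : 0 < K) :
    (∀ m < K, auxEnc c u (i + m) = auxEnc d v (j + m)) ↔
      auxPar c i = auxPar d j ∧ auxBlk K i u = auxBlk K j v := by
  simp only [auxEnc, auxBlk, Prod.mk.injEq, auxPar_add, funext_iff, Fin.forall_iff]
  constructor
  · intro h
    refine ⟨?_, fun m hm => (h m hm).2⟩
    simpa [auxPar] using (h 0 hK).1
  · rintro ⟨h1, h2⟩ m hm
    exact ⟨by rw [h1], h2 m hm⟩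

theorem aux_upper (c d : Bool) (k n : ℕ) (hk : 0 < k) (ρ : ℝ) (hρ : 0 < ρ)
    (hR : (∑' t, γ true {t} * γ true {t}) * (∑' t, γ false {t} * γ false {t}) = ENNReal.ofReal ρ) :
    ((auxNu γ c).prod (auxNu γ d)) {z | ∃ i j, i + 2 * k ≤ n ∧ j + 2 * k ≤ n ∧
      ∀ m < 2 * k, auxEnc c z.1 (i + m) = auxEnc d z.2 (j + m)} ≤ ENNReal.ofReal (n ^ 2 * ρ ^ k) := by
  have hsub : {z : (ℕ → ℕ) × (ℕ → ℕ) | ∃ i j, i + 2 * k ≤ n ∧ j + 2 * k ≤ n ∧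
      ∀ m < 2 * k, auxEnc c z.1 (i + m) = auxEnc d z.2 (j + m)} ⊆
      ⋃ a ∈ Finset.range n ×ˢ Finset.range n, {z | auxPar c a.1 = auxPar d a.2 ∧
        auxBlk (2 * k) a.1 z.1 = auxBlk (2 * k) a.2 z.2} := by
    rintro z ⟨i, j, hi, hj, h⟩
    rw [auxEnc_match (by omega)] at h
    simp only [Set.mem_iUnion]
    exact ⟨(i, j), by simp; omega, h⟩
  refine (measure_mono hsub).trans ((measure_biUnion_finset_le _ _).trans ?_)
  calc _ ≤ ∑ a ∈ Finset.range n ×ˢ Finset.range n, ENNReal.ofReal (ρ ^ k) := by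
        refine Finset.sum_le_sum fun a _ => ?_
        by_cases h : auxPar c a.1 = auxPar d a.2
        · simp only [h, true_and]
          rw [aux_match_meas _ _ _ _ (auxBlk_meas _ _) (auxBlk_meas _ _) _ _
            (auxNu_blk γ c a.1 _) (auxNu_blk γ d a.2 _), h, auxP_sq γ _ k ρ hρ hR]
        · simp [h]
    _ = _ := by
        simp only [Finset.sum_const, Finset.card_product, Finset.card_range, nsmul_eq_mul]
        rw [ENNReal.ofReal_mul (by positivity), ← Nat.cast_pow, ENNReal.ofReal_natCast]
        push_cast; ring

theorem aux_lower (c d : Bool) (k n N : ℕ) (hk : 0 < k) (hN : 0 < N) (hn : 1 + 2 * k * N ≤ n)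
    (σ : ℝ) (hσ : 0 < σ)
    (hR : (∑' t, γ true {t} * γ true {t}) * (∑' t, γ false {t} * γ false {t}) =
      ENNReal.ofReal (σ ^ 2)) :
    ((auxNu γ c).prod (auxNu γ d)).real {z | ¬ ∃ i j, i + 2 * k ≤ n ∧ j + 2 * k ≤ n ∧
      ∀ m < 2 * k, auxEnc c z.1 (i + m) = auxEnc d z.2 (j + m)} ≤
      2 / (N * σ ^ k) + 1 / (N * σ ^ k) ^ 2 := by
  let o : Bool → ℕ := fun b => if b then 0 else 1
  have ho : ∀ b s, auxPar b (o b + 2 * k * s) = true := by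
    intro b s
    cases b <;> simp [auxPar, o, Nat.bodd_add, Nat.bodd_mul]
  have ho1 : ∀ b, o b ≤ 1 := by intro b; cases b <;> simp [o]
  have hind : ∀ b s s', s ≠ s' → ∀ w w', auxNu γ b {u | auxBlk (2 * k) (o b + 2 * k * s) u = w ∧
      auxBlk (2 * k) (o b + 2 * k * s') u = w'} = auxP γ true (2 * k) w * auxP γ true (2 * k) w' := by
    intro b s s' hss w w'
    rcases lt_or_gt_of_ne hss with h | h
    · rw [auxNu_blk2, ho, ho]
      nlinarith
    · have := auxNu_blk2 γ b (o b + 2 * k * s') (o b + 2 * k * s) (2 * k) (by nlinarith) w' w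
      rw [ho, ho] at this
      rw [mul_comm (auxP γ true (2 * k) w), ← this]
      congr 1
      ext u; simp [and_comm]
  have key := aux_matching (auxNu γ c) (auxNu γ d) (fun s => auxBlk (2 * k) (o c + 2 * k * s))
    (fun s => auxBlk (2 * k) (o d + 2 * k * s)) (fun s => auxBlk_meas _ _) (fun s => auxBlk_meas _ _)
    (auxP γ true (2 * k)) (fun s w => by rw [auxNu_blk, ho]) (fun s w => by rw [auxNu_blk, ho])
    (hind c) (hind d) (σ ^ k) (by positivity)
    (by rw [auxP_sq γ true k (σ ^ 2) (by positivity) hR]; congr 1; ring) N hN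
  refine le_trans (measureReal_mono ?_ (measure_ne_top _ _)) key
  intro z hz s hs t ht heq
  apply hz
  have hb : ∀ b : Bool, ∀ s < N, o b + 2 * k * s + 2 * k ≤ n := by
    intro b s hs
    have := ho1 b
    have : 2 * k * (s + 1) ≤ 2 * k * N := Nat.mul_le_mul_left _ hs
    nlinarith
  refine ⟨o c + 2 * k * s, o d + 2 * k * t, hb c s hs, hb d t ht, ?_⟩
  rw [auxEnc_match (by omega)]
  exact ⟨by rw [ho, ho], heq⟩

end blocks
theorem aux_limit (M : ℕ → ℕ) (hM : Monotone M) (h : ℝ) (hh : 0 < h)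
    (hU : ∀ β : ℚ, (0:ℝ) < β → (β : ℝ) < h / 2 → ∀ᶠ k : ℕ in atTop, M ⌊Real.exp (β * k)⌋₊ < 2 * k)
    (hL : ∀ β : ℚ, h / 2 < (β : ℝ) → ∀ᶠ k : ℕ in atTop, 2 * k ≤ M ⌊Real.exp (β * k)⌋₊) :
    Tendsto (fun n : ℕ => (M n : ℝ) / Real.log n) atTop (𝓝 (4 / h)) := by
  have hlog : Tendsto (fun n : ℕ => Real.log n) atTop atTop :=
    Real.tendsto_log_atTop.comp tendsto_natCast_atTop_atTop
  refine tendsto_order.2 ⟨fun a ha => ?_, fun a ha => ?_⟩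
  · obtain ⟨β, hβ, haβ⟩ : ∃ β : ℚ, h / 2 < (β : ℝ) ∧ a < 2 / β := by
      rcases le_or_gt a 0 with h0 | h0
      · obtain ⟨β, hβ⟩ := exists_rat_gt (h / 2)
        exact ⟨β, hβ, lt_of_le_of_lt h0 (by have : (0:ℝ) < β := by linarith
                                            positivity)⟩
      · have : h / 2 < 2 / a := by
          rw [lt_div_iff₀ hh] at ha
          rw [lt_div_iff₀ h0]; nlinarith
        obtain ⟨β, h1, h2⟩ := exists_rat_btwn this
        refine ⟨β, h1, ?_⟩
        have : (0:ℝ) < β := by linarith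
        rw [lt_div_iff₀ h0] at h2
        rw [lt_div_iff₀ this]; linarith
    have hβ0 : (0:ℝ) < β := by linarith
    have hk : Tendsto (fun n : ℕ => ⌊Real.log n / β⌋₊) atTop atTop :=
      tendsto_nat_floor_atTop.comp (hlog.atTop_div_const hβ0)
    filter_upwards [hk.eventually (hL β hβ), hlog.eventually_gt_atTop (2 / (2 / β - a)),
      hlog.eventually_gt_atTop 0, eventually_gt_atTop 0] with n h1 h2 h3 h4
    have hn : (0:ℝ) < n := by exact_mod_cast h4
    have h5 : ⌊Real.exp (β * (⌊Real.log n / β⌋₊ : ℕ))⌋₊ ≤ n := by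
      refine Nat.floor_le_of_le ?_
      rw [← Real.le_log_iff_exp_le hn]
      have := Nat.floor_le (a := Real.log n / β) (by positivity)
      rw [le_div_iff₀ hβ0] at this; linarith
    have h6 : 2 * ⌊Real.log n / β⌋₊ ≤ M n := h1.trans (hM h5)
    have h6' : (2 * ⌊Real.log n / β⌋₊ : ℝ) ≤ M n := by exact_mod_cast h6
    have h7 := Nat.lt_floor_add_one (Real.log n / β)
    rw [lt_div_iff₀ h3]
    rw [div_lt_iff₀ (by linarith)] at h2
    have h8 : Real.log n * (2 / β - a) = 2 * (Real.log n / β) - a * Real.log n := by ring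
    linarith
  · have ha0 : 0 < a := lt_trans (by positivity) ha
    obtain ⟨β, h1, h2⟩ : ∃ β : ℚ, 2 / a < (β : ℝ) ∧ (β : ℝ) < h / 2 := by
      apply exists_rat_btwn
      rw [gt_iff_lt, div_lt_iff₀ hh] at ha
      rw [div_lt_iff₀ ha0]; nlinarith
    have hβ0 : (0:ℝ) < β := lt_trans (by positivity) h1
    have haβ : 2 / β < a := by
      rw [div_lt_iff₀ ha0] at h1
      rw [div_lt_iff₀ hβ0]; linarith
    have hk : Tendsto (fun n : ℕ => ⌈Real.log n / β⌉₊) atTop atTop :=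
      tendsto_nat_ceil_atTop.comp (hlog.atTop_div_const hβ0)
    filter_upwards [hk.eventually (hU β hβ0 h2), hlog.eventually_gt_atTop (2 / (a - 2 / β)),
      hlog.eventually_gt_atTop 0, eventually_gt_atTop 0] with n h1 h2 h3 h4
    have hn : (0:ℝ) < n := by exact_mod_cast h4
    have h5 : n ≤ ⌊Real.exp (β * (⌈Real.log n / β⌉₊ : ℕ))⌋₊ := by
      refine Nat.le_floor ?_
      rw [← Real.log_le_iff_le_exp hn]
      have := Nat.le_ceil (Real.log n / β)
      rw [div_le_iff₀ hβ0] at this; linarith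
    have h6 : M n < 2 * ⌈Real.log n / β⌉₊ := (hM h5).trans_lt h1
    have h6' : (M n : ℝ) < 2 * ⌈Real.log n / β⌉₊ := by exact_mod_cast h6
    have h7 := Nat.ceil_lt_add_one (a := Real.log n / β) (by positivity)
    rw [div_lt_iff₀ h3]
    rw [div_lt_iff₀ (by linarith)] at h2
    have h8 : Real.log n * (a - 2 / β) = a * Real.log n - 2 * (Real.log n / β) := by ring
    linarith

theorem aux_matchLen_le {C : Type*} (u v : ℕ → C) (n k : ℕ) :
    k ≤ matchLen u v n ↔ ∃ i j, i + k ≤ n ∧ j + k ≤ n ∧ ∀ m < k, u (i + m) = v (j + m) := by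
  have hb : BddAbove {k | ∃ i j, i + k ≤ n ∧ j + k ≤ n ∧ ∀ m < k, u (i + m) = v (j + m)} :=
    ⟨n, by rintro k ⟨i, j, h, -⟩; omega⟩
  constructor
  · intro h
    have hne : {k | ∃ i j, i + k ≤ n ∧ j + k ≤ n ∧ ∀ m < k, u (i + m) = v (j + m)}.Nonempty :=
      ⟨0, 0, 0, by simp⟩
    obtain ⟨i, j, h1, h2, h3⟩ := Nat.sSup_mem hne hb
    change i + matchLen u v n ≤ n at h1
    change j + matchLen u v n ≤ n at h2
    change ∀ m < matchLen u v n, _ at h3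
    exact ⟨i, j, by omega, by omega, fun m hm => h3 m (by omega)⟩
  · intro h
    exact le_csSup hb h

theorem aux_matchLen_mono {C : Type*} (u v : ℕ → C) : Monotone (matchLen u v) := by
  intro n n' h
  obtain ⟨i, j, h1, h2, h3⟩ := (aux_matchLen_le u v n _).1 le_rfl
  exact (aux_matchLen_le u v n' _).2 ⟨i, j, by omega, by omega, h3⟩

theorem aux_lim_nu (γ : Bool → Measure ℕ) [∀ b, IsProbabilityMeasure (γ b)] (c d : Bool)
    (h : ℝ) (hh : 0 < h)
    (hR : (∑' t, γ true {t} * γ true {t}) * (∑' t, γ false {t} * γ false {t}) =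
      ENNReal.ofReal (Real.exp (-h))) :
    ∀ᵐ z ∂((auxNu γ c).prod (auxNu γ d)),
      Tendsto (fun n : ℕ => (matchLen (auxEnc c z.1) (auxEnc d z.2) n : ℝ) / Real.log n) atTop
        (𝓝 (4 / h)) := by
  have HU : ∀ β : ℚ, ∀ᵐ z ∂((auxNu γ c).prod (auxNu γ d)), (0:ℝ) < β → (β : ℝ) < h / 2 →
      ∀ᶠ k : ℕ in atTop, matchLen (auxEnc c z.1) (auxEnc d z.2) ⌊Real.exp (β * k)⌋₊ < 2 * k := by
    intro β
    by_cases hβ0 : (0:ℝ) < β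
    swap
    · simp [hβ0]
    by_cases hβ : (β : ℝ) < h / 2
    swap
    · simp [hβ]
    have hsum : Summable (fun k : ℕ => Real.exp (k * (2 * β - h))) := by
      rw [Real.summable_exp_nat_mul_iff]; linarith
    have := ae_eventually_notMem (μ := (auxNu γ c).prod (auxNu γ d)) (s := fun k =>
      {z | ∃ i j, i + 2 * k ≤ ⌊Real.exp (β * k)⌋₊ ∧ j + 2 * k ≤ ⌊Real.exp (β * k)⌋₊ ∧
      ∀ m < 2 * k, auxEnc c z.1 (i + m) = auxEnc d z.2 (j + m)}) (by
        refine ne_top_of_le_ne_top hsum.tsum_ofReal_ne_top (ENNReal.tsum_le_tsum fun k => ?_)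
        rcases Nat.eq_zero_or_pos k with rfl | hk
        · refine prob_le_one.trans ?_
          simp
        · refine (aux_upper γ c d k _ hk _ (Real.exp_pos _) hR).trans (ENNReal.ofReal_le_ofReal ?_)
          have h1 : (⌊Real.exp (β * k)⌋₊ : ℝ) ≤ Real.exp (β * k) := Nat.floor_le (Real.exp_pos _).le
          calc _ ≤ Real.exp (β * k) ^ 2 * Real.exp (-h) ^ k := by gcongr
            _ = _ := by
              rw [← Real.exp_nat_mul, ← Real.exp_nat_mul, ← Real.exp_add]; congr 1; push_cast; ring)
    filter_upwards [this] with z hz _ _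
    filter_upwards [hz] with k hk
    by_contra! hc
    rw [aux_matchLen_le] at hc
    exact hk (by simpa using hc)
  have HL : ∀ β : ℚ, ∀ᵐ z ∂((auxNu γ c).prod (auxNu γ d)), h / 2 < (β : ℝ) →
      ∀ᶠ k : ℕ in atTop, 2 * k ≤ matchLen (auxEnc c z.1) (auxEnc d z.2) ⌊Real.exp (β * k)⌋₊ := by
    intro β
    by_cases hβ : h / 2 < (β : ℝ)
    swap
    · simp [hβ]
    set δ : ℝ := (β - h / 2) / 2 with hδ
    have hδ0 : 0 < δ := by linarith
    set b : ℝ := h / 2 + δ with hb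
    let N : ℕ → ℕ := fun k => ⌊Real.exp (b * k)⌋₊
    have hsum : Summable (fun k : ℕ => 8 * Real.exp (k * (-δ))) := by
      apply Summable.mul_left
      rw [Real.summable_exp_nat_mul_iff]; linarith
    have hcond : ∀ᶠ k : ℕ in atTop, 0 < k ∧ 1 + 2 * k * N k ≤ ⌊Real.exp (β * k)⌋₊ := by
      have ht : Tendsto (fun k : ℕ => Real.exp (δ * k) / (δ * k) ^ 1) atTop atTop :=
        (Real.tendsto_exp_div_pow_atTop 1).comp
          (tendsto_natCast_atTop_atTop.const_mul_atTop hδ0)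
      filter_upwards [eventually_gt_atTop 0, ht.eventually_ge_atTop (3 / δ)] with k hk hk2
      refine ⟨hk, Nat.le_floor ?_⟩
      have hkr : (1:ℝ) ≤ k := by exact_mod_cast hk
      have h1 : (N k : ℝ) ≤ Real.exp (b * k) := Nat.floor_le (Real.exp_pos _).le
      have h2 : (1:ℝ) ≤ Real.exp (b * k) := Real.one_le_exp (by positivity)
      have h3 : 3 * (k:ℝ) ≤ Real.exp (δ * k) := by
        rw [pow_one, div_le_div_iff₀ hδ0 (by positivity)] at hk2
        nlinarith
      have h4 : Real.exp (β * k) = Real.exp (b * k) * Real.exp (δ * k) := by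
        rw [← Real.exp_add]; congr 1; rw [hb, hδ]; ring
      push_cast
      rw [h4]
      calc 1 + 2 * (k:ℝ) * N k ≤ k * Real.exp (b * k) + 2 * k * Real.exp (b * k) := by
            gcongr
            nlinarith
        _ = Real.exp (b * k) * (3 * k) := by ring
        _ ≤ _ := by gcongr
    have := ae_eventually_notMem (μ := (auxNu γ c).prod (auxNu γ d)) (s := fun k =>
      {z | (0 < k ∧ 1 + 2 * k * N k ≤ ⌊Real.exp (β * k)⌋₊) ∧
        ¬ ∃ i j, i + 2 * k ≤ ⌊Real.exp (β * k)⌋₊ ∧ j + 2 * k ≤ ⌊Real.exp (β * k)⌋₊ ∧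
      ∀ m < 2 * k, auxEnc c z.1 (i + m) = auxEnc d z.2 (j + m)}) (by
        refine ne_top_of_le_ne_top hsum.tsum_ofReal_ne_top (ENNReal.tsum_le_tsum fun k => ?_)
        by_cases hc : 0 < k ∧ 1 + 2 * k * N k ≤ ⌊Real.exp (β * k)⌋₊
        swap
        · simp [hc]
        simp only [hc, true_and, and_self]
        have hx1 : (1:ℝ) ≤ Real.exp (b * k) := Real.one_le_exp (by positivity)
        have hN1 : 1 ≤ N k := Nat.le_floor (by simpa using hx1)
        have hN1r : (1:ℝ) ≤ N k := by exact_mod_cast hN1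
        have hN2 : Real.exp (b * k) / 2 ≤ N k := by
          have := Nat.lt_floor_add_one (Real.exp (b * k))
          change _ < (N k : ℝ) + 1 at this
          linarith
        have key := aux_lower γ c d k _ (N k) hc.1 hN1 hc.2 (Real.exp (-h / 2)) (Real.exp_pos _)
          (by rw [hR, ← Real.exp_nat_mul]; congr 2; push_cast; ring)
        rw [← ENNReal.ofReal_toReal (measure_ne_top ((auxNu γ c).prod (auxNu γ d)) _)]
        refine ENNReal.ofReal_le_ofReal (le_trans key ?_)
        have h5 : Real.exp (k * δ) / 2 ≤ N k * Real.exp (-h / 2) ^ k := by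
          calc Real.exp (k * δ) / 2 = Real.exp (b * k) / 2 * Real.exp (-h / 2) ^ k := by
                rw [← Real.exp_nat_mul, div_mul_eq_mul_div, ← Real.exp_add]; congr 2; rw [hb]; ring
            _ ≤ _ := by gcongr
        have h6 : 1 ≤ Real.exp (k * δ) := Real.one_le_exp (by positivity)
        set X := Real.exp (k * δ)
        have hX : 0 < X := by linarith
        calc _ ≤ 2 / (X / 2) + 1 / (X / 2) ^ 2 := by gcongr
          _ = 4 / X + 4 / X * (1 / X) := by field_simp; norm_num
          _ ≤ 4 / X + 4 / X * 1 := by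
            gcongr
            rw [div_le_one hX]; exact h6
          _ = 8 * Real.exp (k * (-δ)) := by
            rw [mul_neg, Real.exp_neg]
            change _ = 8 * X⁻¹
            field_simp; norm_num)
    filter_upwards [this] with z hz _
    filter_upwards [hz, hcond] with k hk hk2
    rw [aux_matchLen_le]
    by_contra hc
    exact hk ⟨hk2, by simpa using hc⟩
  filter_upwards [ae_all_iff.2 HU, ae_all_iff.2 HL] with z h1 h2
  exact aux_limit _ (aux_matchLen_mono _ _) h hh h1 h2
theorem aux_ext {α : Type*} [Inhabited α] [Countable α] [MeasurableSpace α]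
    [MeasurableSingletonClass α] (m₁ m₂ : Measure (ℕ → α)) [IsFiniteMeasure m₁]
    (h : ∀ (n : ℕ) (w : ℕ → α), m₁ {x | ∀ i < n, x i = w i} = m₂ {x | ∀ i < n, x i = w i}) :
    m₁ = m₂ := by
  have hmeas : ∀ (n : ℕ) (w : ℕ → α), MeasurableSet {x : ℕ → α | ∀ i < n, x i = w i} := by
    intro n w
    have : {x : ℕ → α | ∀ i < n, x i = w i} = ⋂ i, ⋂ (_ : i < n), (fun x => x i) ⁻¹' {w i} := by
      ext; simp
    rw [this]
    exact MeasurableSet.iInter fun i => MeasurableSet.iInter fun _ =>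
      (measurable_pi_apply i) (measurableSet_singleton _)
  refine ext_of_generate_finite {S | ∃ (n : ℕ) (w : ℕ → α), S = {x | ∀ i < n, x i = w i}} ?_ ?_ ?_ ?_
  · apply le_antisymm
    · refine iSup_le fun i => ?_
      rw [← measurable_iff_comap_le]
      refine @measurable_to_countable' _ _ _ _ (_) _ fun a => ?_
      have : (fun x : ℕ → α => x i) ⁻¹' {a} = ⋃ w : Fin i → α,
          {x | ∀ j < i + 1, x j = if h : j < i then w ⟨j, h⟩ else a} := by
        ext x
        simp only [Set.mem_preimage, Set.mem_singleton_iff, Set.mem_iUnion, Set.mem_ofPred_eq]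
        constructor
        · intro hx
          refine ⟨fun j => x j, fun j hj => ?_⟩
          split_ifs with h1
          · rfl
          · have : j = i := by omega
            rw [this, hx]
        · rintro ⟨w, hw⟩
          simpa using hw i (by omega)
      rw [this]
      refine MeasurableSet.iUnion fun w => ?_
      exact MeasurableSpace.measurableSet_generateFrom ⟨i + 1, _, rfl⟩
    · refine MeasurableSpace.generateFrom_le ?_
      rintro S ⟨n, w, rfl⟩
      exact hmeas n w
  · rintro S ⟨n, w, rfl⟩ S' ⟨n', w', rfl⟩ ⟨x, hx, hx'⟩
    refine ⟨max n n', x, ?_⟩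
    ext y
    simp only [Set.mem_inter_iff, Set.mem_ofPred_eq] at hx hx' ⊢
    constructor
    · rintro ⟨h1, h2⟩ i hi
      rcases lt_max_iff.1 hi with h3 | h3
      · rw [h1 i h3, hx i h3]
      · rw [h2 i h3, hx' i h3]
    · intro h1
      exact ⟨fun i hi => by rw [h1 i (lt_max_of_lt_left hi), hx i hi],
        fun i hi => by rw [h1 i (lt_max_of_lt_right hi), hx' i hi]⟩
  · rintro S ⟨n, w, rfl⟩
    exact h n w
  · simpa using h 0 (fun _ => default)

section combinatorics
variable {A : Type*}

theorem aux_nextChange_shift (x : ℕ → A) (s i : ℕ) :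
    nextChange x (i + s) = nextChange (fun n => x (n + s)) i + s := by
  classical
  have e : ∀ j, i + s + j + 1 = i + j + 1 + s := by intro j; omega
  simp only [nextChange, e]
  split_ifs <;> omega

theorem aux_runStart_shift (x : ℕ → A) (n : ℕ) :
    runStart x (n + 1) = runStart (fun m => x (m + nextChange x 0)) n + nextChange x 0 := by
  induction n with
  | zero => simp [runStart]
  | succ n ih =>
    rw [runStart, ih, aux_nextChange_shift]
    rfl

theorem aux_lt_nextChange (x : ℕ → A) (i : ℕ) : i < nextChange x i := by
  classical
  simp only [nextChange]
  split_ifs <;> omega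

theorem aux_nextChange_eq (x : ℕ → A) (i k : ℕ) (hg : ∃ j, x (i + j + 1) ≠ x i) :
    nextChange x i = i + k + 1 ↔ (∀ t < k, x (i + t + 1) = x i) ∧ x (i + k + 1) ≠ x i := by
  classical
  simp only [nextChange, dif_pos hg]
  have : i + Nat.find hg + 1 = i + k + 1 ↔ Nat.find hg = k := by omega
  rw [this, Nat.find_eq_iff]
  simp only [ne_eq, not_not]
  tauto

/-- Run lengths. -/
noncomputable def auxT (x : ℕ → A) (n : ℕ) : ℕ := runStart x (n + 1) - runStart x n

theorem auxT_zero (x : ℕ → A) : auxT x 0 = nextChange x 0 := by simp [auxT, runStart]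

theorem auxT_succ (x : ℕ → A) (n : ℕ) : auxT x (n + 1) = auxT (fun m => x (m + nextChange x 0)) n := by
  rw [auxT, auxT, aux_runStart_shift, aux_runStart_shift x n]
  omega

theorem aux_rle (x : ℕ → Bool) (hg : ∀ i, ∃ j, x (i + j + 1) ≠ x i) : rle x = auxEnc (x 0) (auxT x) := by
  funext n
  simp only [rle, auxEnc, auxT, Prod.mk.injEq, and_true]
  induction n with
  | zero => simp [runStart, auxPar]
  | succ n ih =>
    obtain ⟨k, hk⟩ : ∃ k, nextChange x (runStart x n) = runStart x n + k + 1 :=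
      ⟨nextChange x (runStart x n) - runStart x n - 1, by have := aux_lt_nextChange x (runStart x n); omega⟩
    have h2 := ((aux_nextChange_eq x _ k (hg _)).1 hk).2
    rw [runStart, hk]
    rw [auxPar_add, ← ih]
    revert h2
    generalize x (runStart x n + k + 1) = a
    generalize x (runStart x n) = b
    cases a <;> cases b <;> simp [auxPar]

theorem aux_nextChange_meas (i : ℕ) : Measurable (fun x : ℕ → Bool => nextChange x i) := by
  classical
  have hm : ∀ j, MeasurableSet {x : ℕ → Bool | x (i + j + 1) ≠ x i} := fun j =>
    (measurableSet_eq_fun (f := fun x : ℕ → Bool => x (i + j + 1)) (g := fun x => x i)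
      (measurable_pi_apply _) (measurable_pi_apply _)).compl
  have hm' : MeasurableSet {x : ℕ → Bool | ∀ j, ¬ x (i + j + 1) ≠ x i} := by
    have : {x : ℕ → Bool | ∀ j, ¬ x (i + j + 1) ≠ x i} = ⋂ j, {x : ℕ → Bool | x (i + j + 1) ≠ x i}ᶜ := by
      ext; simp
    rw [this]
    exact MeasurableSet.iInter fun j => (hm j).compl
  let q : (ℕ → Bool) → ℕ → Prop := fun x j => x (i + j + 1) ≠ x i ∨ ∀ j, ¬ x (i + j + 1) ≠ x i
  have hq : ∀ x, ∃ j, q x j := by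
    intro x
    by_cases h : ∃ j, x (i + j + 1) ≠ x i
    · exact h.imp fun j hj => Or.inl hj
    · exact ⟨0, Or.inr (not_exists.1 h)⟩
  have h1 := measurable_find hq (fun k => (hm k).union hm')
  have h2 : (fun x : ℕ → Bool => nextChange x i) = fun x => i + Nat.find (hq x) + 1 := by
    funext x
    by_cases h : ∃ j, x (i + j + 1) ≠ x i
    · rw [aux_nextChange_eq x i _ h]
      have h3 := Nat.find_spec (hq x)
      have h4 := fun t ht => Nat.find_min (hq x) (m := t) ht
      simp only [q, not_or] at h3 h4
      refine ⟨fun t ht => by simpa using (h4 t ht).1, ?_⟩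
      rcases h3 with h3 | h3
      · exact h3
      · exact absurd h (not_exists.2 h3)
    · have : Nat.find (hq x) = 0 := by
        rw [Nat.find_eq_zero]
        exact Or.inr (not_exists.1 h)
      rw [this]
      simp only [nextChange, dif_neg h, add_zero]
  rw [h2]
  exact (h1.const_add i).add_const 1

theorem aux_runStart_meas (n : ℕ) : Measurable (fun x : ℕ → Bool => runStart x n) := by
  induction n with
  | zero => exact measurable_const
  | succ n ih =>
    refine measurable_to_countable' fun m => ?_
    have : (fun x : ℕ → Bool => runStart x (n + 1)) ⁻¹' {m} =
        ⋃ i, ((fun x : ℕ → Bool => runStart x n) ⁻¹' {i} ∩ (fun x : ℕ → Bool => nextChange x i) ⁻¹' {m}) := by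
      ext x
      simp [runStart]
    rw [this]
    exact MeasurableSet.iUnion fun i => (ih (measurableSet_singleton _)).inter
      (aux_nextChange_meas i (measurableSet_singleton _))

theorem auxT_meas : Measurable (auxT : (ℕ → Bool) → ℕ → ℕ) := by
  refine measurable_pi_lambda _ fun n => ?_
  exact (aux_runStart_meas (n + 1)).sub (aux_runStart_meas n)

end combinatorics
theorem aux_tsum_ofReal {f : ℕ → ℝ} {s : ℝ} (hf : ∀ n, 0 ≤ f n) (h : HasSum f s) :
    ∑' n, ENNReal.ofReal (f n) = ENNReal.ofReal s := by
  rw [← ENNReal.ofReal_tsum_of_nonneg hf h.summable, h.tsum_eq]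

theorem aux_exists_geo (q : ℝ) (hq0 : 0 < q) (hq1 : q < 1) :
    ∃ γ : Measure ℕ, IsProbabilityMeasure γ ∧ γ {0} = 0 ∧
      (∀ t, γ {t + 1} = ENNReal.ofReal (q ^ t * (1 - q))) ∧
      ∑' t, γ {t} * γ {t} = ENNReal.ofReal ((1 - q) / (1 + q)) := by
  have h1q : 0 < 1 - q := by linarith
  let g : ℕ → ℝ := fun t => if t = 0 then 0 else q ^ (t - 1) * (1 - q)
  have hg : ∀ t, 0 ≤ g t := by
    intro t; simp only [g]; split_ifs <;> positivity
  have hs : HasSum g 1 := by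
    rw [← hasSum_nat_add_iff' 1]
    have := (hasSum_geometric_of_lt_one hq0.le hq1).mul_right (1 - q)
    rw [inv_mul_cancel₀ h1q.ne'] at this
    simpa [g] using this
  have hs2 : HasSum (fun t => g t * g t) ((1 - q) / (1 + q)) := by
    rw [← hasSum_nat_add_iff' 1]
    have := (hasSum_geometric_of_lt_one (r := q ^ 2) (by positivity) (by nlinarith)).mul_right ((1 - q) ^ 2)
    have e1 : (fun n => g (n + 1) * g (n + 1)) = fun i => (q ^ 2) ^ i * (1 - q) ^ 2 := by
      funext t
      simp only [g, Nat.add_eq_zero_iff, one_ne_zero, and_false, if_false, Nat.add_sub_cancel]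
      ring
    have e2 : (1 - q) / (1 + q) - ∑ i ∈ Finset.range 1, g i * g i
        = (1 - q ^ 2)⁻¹ * (1 - q) ^ 2 := by
      have h0 : 1 - q ^ 2 = (1 - q) * (1 + q) := by ring
      have h2 : 1 + q ≠ 0 := by positivity
      have h3 := h1q.ne'
      rw [h0]
      simp only [g, Finset.sum_range_one, if_true, mul_zero, sub_zero]
      field_simp
    rw [← e1, ← e2] at this
    exact this
  let P : PMF ℕ := ⟨fun t => ENNReal.ofReal (g t), by
    rw [ENNReal.summable.hasSum_iff, aux_tsum_ofReal hg hs, ENNReal.ofReal_one]⟩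
  have hP : ∀ t, P.toMeasure {t} = ENNReal.ofReal (g t) := fun t =>
    P.toMeasure_apply_singleton t (measurableSet_singleton t)
  refine ⟨P.toMeasure, inferInstance, ?_, ?_, ?_⟩
  · rw [hP]; simp [g]
  · intro t; rw [hP]; simp [g]
  · simp_rw [hP, ← ENNReal.ofReal_mul (hg _)]
    exact aux_tsum_ofReal (fun t => mul_nonneg (hg t) (hg t)) hs2

/-- Probability of a letter. -/
def auxPr (p : ℝ) (c : Bool) : ℝ := if c then p else 1 - p

section law
variable (p : ℝ) (hp0 : 0 < p) (hp1 : p < 1) (μ : Measure (ℕ → Bool)) [IsProbabilityMeasure μ]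
    (hμ : ∀ (n : ℕ) (w : Fin n → Bool),
      μ {x | ∀ i : Fin n, x i = w i} =
        ENNReal.ofReal (∏ i : Fin n, if w i then p else 1 - p))

theorem aux_meas0 (c : Bool) : MeasurableSet {x : ℕ → Bool | x 0 = c} := by
  have := (measurable_pi_apply (X := fun _ : ℕ => Bool) 0) (measurableSet_singleton c)
  exact this

theorem aux_shift_meas : Measurable (shift : (ℕ → Bool) → ℕ → Bool) := by
  unfold shift; fun_prop

include hp0 hp1 hμ

theorem aux_hmu (n : ℕ) (w : ℕ → Bool) :
    μ {x | ∀ i < n, x i = w i} = ENNReal.ofReal (∏ i ∈ Finset.range n, auxPr p (w i)) := by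
  have := hμ n (fun i => w i)
  rw [Finset.prod_range]
  unfold auxPr
  rw [← this]
  congr 1
  ext x
  simp [Fin.forall_iff]

theorem aux_step (c : Bool) (B : Set (ℕ → Bool)) (hB : MeasurableSet B) :
    μ {x | x 0 = c ∧ shift x ∈ B} = ENNReal.ofReal (auxPr p c) * μ B := by
  have hpr : ∀ b, 0 ≤ auxPr p b := by intro b; cases b <;> simp [auxPr] <;> linarith
  have key : (μ.restrict {x | x 0 = c}).map shift = ENNReal.ofReal (auxPr p c) • μ := by
    have : IsFiniteMeasure ((μ.restrict {x | x 0 = c}).map shift) := inferInstance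
    apply aux_ext
    intro n w
    have hm : MeasurableSet {x : ℕ → Bool | ∀ i < n, x i = w i} := by
      have : {x : ℕ → Bool | ∀ i < n, x i = w i} = ⋂ i, ⋂ (_ : i < n), (fun x => x i) ⁻¹' {w i} := by
        ext; simp
      rw [this]
      exact MeasurableSet.iInter fun i => MeasurableSet.iInter fun _ =>
        (measurable_pi_apply i) (measurableSet_singleton _)
    rw [Measure.map_apply aux_shift_meas hm, Measure.restrict_apply (aux_shift_meas hm),
      Measure.smul_apply, smul_eq_mul, aux_hmu p hp0 hp1 μ hμ, ← ENNReal.ofReal_mul (hpr c)]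
    have := aux_hmu p hp0 hp1 μ hμ (n + 1) (fun i => if i = 0 then c else w (i - 1))
    rw [Finset.prod_range_succ'] at this
    simp only [Nat.add_eq_zero_iff, one_ne_zero, and_false, if_false, Nat.add_sub_cancel, if_true] at this
    rw [mul_comm, ← this]
    congr 1
    ext x
    simp only [shift, Set.mem_inter_iff, Set.mem_preimage, Set.mem_ofPred_eq]
    constructor
    · rintro ⟨h1, h2⟩ i hi
      rcases i with _ | i
      · simpa using h2
      · simpa using h1 i (by omega)
    · intro h
      exact ⟨fun i hi => by simpa using h (i + 1) (by omega), by simpa using h 0 (by omega)⟩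
  have := congrArg (fun m => m B) key
  simp only [Measure.smul_apply, smul_eq_mul] at this
  rw [Measure.map_apply aux_shift_meas hB, Measure.restrict_apply (aux_shift_meas hB)] at this
  rw [← this]
  congr 1
  ext x
  simp [and_comm]

theorem aux_steps (c : Bool) (k : ℕ) (B : Set (ℕ → Bool)) (hB : MeasurableSet B) :
    μ {x | (∀ t < k, x t = c) ∧ (fun n => x (n + k)) ∈ B} =
      ENNReal.ofReal (auxPr p c) ^ k * μ B := by
  induction k with
  | zero =>
    simp
    rfl
  | succ k ih =>
    have hm : MeasurableSet {x : ℕ → Bool | (∀ t < k, x t = c) ∧ (fun n => x (n + k)) ∈ B} := by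
      have : {x : ℕ → Bool | (∀ t < k, x t = c) ∧ (fun n => x (n + k)) ∈ B} =
          (⋂ i, ⋂ (_ : i < k), (fun x => x i) ⁻¹' {c}) ∩ (fun x n => x (n + k)) ⁻¹' B := by
        ext; simp
      rw [this]
      refine (MeasurableSet.iInter fun i => MeasurableSet.iInter fun _ =>
        (measurable_pi_apply i) (measurableSet_singleton _)).inter ?_
      refine MeasurableSet.preimage hB ?_
      fun_prop
    rw [pow_succ', mul_assoc, ← ih, ← aux_step p hp0 hp1 μ hμ c _ hm]
    congr 1
    ext x
    simp only [shift, Set.mem_ofPred_eq]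
    have e : ∀ n, n + (k + 1) = n + k + 1 := fun n => rfl
    simp only [e, ← and_assoc]
    refine and_congr_left fun _ => ?_
    constructor
    · intro h; exact ⟨h 0 (by omega), fun t ht => h (t + 1) (by omega)⟩
    · rintro ⟨h1, h2⟩ t ht
      rcases t with _ | t
      · exact h1
      · exact h2 t (by omega)

theorem aux_good : ∀ᵐ x ∂μ, ∀ i, ∃ j, x (i + j + 1) ≠ x i := by
  have hac : μ.map shift ≪ μ := by
    refine Measure.AbsolutelyContinuous.mk fun s hs h0 => ?_
    rw [Measure.map_apply aux_shift_meas hs]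
    have : shift ⁻¹' s ⊆ {x : ℕ → Bool | x 0 = true ∧ shift x ∈ s} ∪ {x | x 0 = false ∧ shift x ∈ s} := by
      intro x hx
      cases h : x 0
      · exact Or.inr ⟨h, hx⟩
      · exact Or.inl ⟨h, hx⟩
    refine measure_mono_null this (measure_union_null ?_ ?_) <;>
      rw [aux_step p hp0 hp1 μ hμ _ _ hs, h0, mul_zero]
  have hzero : ∀ c : Bool, μ {x | ∀ t, x t = c} = 0 := by
    intro c
    have hm : MeasurableSet {x : ℕ → Bool | ∀ t, x t = c} := by
      have : {x : ℕ → Bool | ∀ t, x t = c} = ⋂ t, (fun x => x t) ⁻¹' {c} := by ext; simp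
      rw [this]
      exact MeasurableSet.iInter fun i => (measurable_pi_apply i) (measurableSet_singleton _)
    have h1 := aux_step p hp0 hp1 μ hμ c _ hm
    have h2 : {x : ℕ → Bool | x 0 = c ∧ shift x ∈ {x : ℕ → Bool | ∀ t, x t = c}} = {x | ∀ t, x t = c} := by
      ext x
      simp only [shift, Set.mem_ofPred_eq]
      exact ⟨fun h t => by rcases t with _ | t; exacts [h.1, h.2 t], fun h => ⟨h 0, fun t => h _⟩⟩
    rw [h2] at h1
    by_contra hne
    have hlt : ENNReal.ofReal (auxPr p c) < 1 := by
      rw [ENNReal.ofReal_lt_one]; cases c <;> simp [auxPr] <;> linarith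
    have := ENNReal.mul_lt_mul_left hne (measure_ne_top _ _) hlt
    rw [one_mul, ← h1] at this
    exact lt_irrefl _ this
  rw [ae_all_iff]
  intro i
  induction i with
  | zero =>
    have h1 : ∀ c : Bool, ∀ᵐ x ∂μ, ¬ ∀ t, x t = c := fun c => by
      rw [ae_iff]; simpa using hzero c
    filter_upwards [h1 true, h1 false] with x h2 h3
    by_contra! h4
    have h5 : ∀ t, x t = x 0 := by
      intro t
      rcases t with _ | t
      · rfl
      · simpa using h4 t
    cases h : x 0 <;> simp_all
  | succ i ih =>
    have := ae_of_ae_map aux_shift_meas.aemeasurable (hac.ae_le ih)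
    filter_upwards [this] with x hx
    obtain ⟨j, hj⟩ := hx
    refine ⟨j, ?_⟩
    rw [show i + 1 + j + 1 = i + j + 1 + 1 by omega]
    exact hj

theorem aux_law_cyl (γ : Bool → Measure ℕ) (h0 : ∀ b, γ b {0} = 0)
    (h1 : ∀ b t, γ b {t + 1} = ENNReal.ofReal (auxPr p b ^ t * (1 - auxPr p b)))
    (n : ℕ) (c : Bool) (k : ℕ → ℕ) :
    μ {x | x 0 = c ∧ ∀ i < n, auxT x i = k i} =
      ENNReal.ofReal (auxPr p c) * ∏ i ∈ Finset.range n, γ (auxPar c i) {k i} := by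
  have hpr : ∀ b, 0 ≤ auxPr p b := by intro b; cases b <;> simp [auxPr] <;> linarith
  induction n generalizing c k with
  | zero =>
    have := aux_hmu p hp0 hp1 μ hμ 1 (fun _ => c)
    simpa using this
  | succ n ih =>
    rw [Finset.prod_range_succ']
    have hpar0 : auxPar c 0 = c := by simp [auxPar]
    have hpar1 : ∀ i, auxPar c (i + 1) = auxPar (!c) i := by
      intro i; cases c <;> simp [auxPar]
    rcases hk : k 0 with _ | k0
    · rw [h0, mul_zero, mul_zero]
      convert measure_empty (μ := μ)
      ext x
      simp only [Set.mem_ofPred_eq, Set.mem_empty_iff_false, iff_false]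
      rintro ⟨-, h2⟩
      have h3 := h2 0 (by omega)
      rw [auxT_zero, hk] at h3
      have := aux_lt_nextChange x 0
      omega
    · have hB : MeasurableSet {y : ℕ → Bool | y 0 = !c ∧ ∀ i < n, auxT y i = k (i + 1)} := by
        have : {y : ℕ → Bool | y 0 = !c ∧ ∀ i < n, auxT y i = k (i + 1)} =
            {y | y 0 = !c} ∩ ⋂ i, ⋂ (_ : i < n), (fun y => auxT y i) ⁻¹' {k (i + 1)} := by
          ext; simp
        rw [this]
        exact (aux_meas0 _).inter (MeasurableSet.iInter fun i => MeasurableSet.iInter fun _ =>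
          ((measurable_pi_apply i).comp auxT_meas) (measurableSet_singleton _))
      have h2 := aux_steps p hp0 hp1 μ hμ c (k0 + 1) _ hB
      rw [ih] at h2
      have h3 : μ {x | x 0 = c ∧ ∀ i < n + 1, auxT x i = k i} =
          μ {x | (∀ t < k0 + 1, x t = c) ∧ (fun n => x (n + (k0 + 1))) ∈
            {y : ℕ → Bool | y 0 = !c ∧ ∀ i < n, auxT y i = k (i + 1)}} := by
        refine measure_congr ?_
        filter_upwards [aux_good p hp0 hp1 μ hμ] with x hx
        apply propext
        change (x 0 = c ∧ ∀ i < n + 1, auxT x i = k i) ↔ ((∀ t < k0 + 1, x t = c) ∧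
          (x (0 + (k0 + 1)) = !c ∧ ∀ i < n, auxT (fun n => x (n + (k0 + 1))) i = k (i + 1)))
        have hchar := aux_nextChange_eq x 0 k0 (hx 0)
        simp only [zero_add] at hchar ⊢
        constructor
        · rintro ⟨h4, h5⟩
          have h6 := h5 0 (by omega)
          rw [auxT_zero, hk] at h6
          have h7 := hchar.1 h6
          refine ⟨fun t ht => ?_, ?_, fun i hi => ?_⟩
          · rcases t with _ | t
            · exact h4
            · rw [h7.1 t (by omega), h4]
          · have := h7.2
            rw [h4] at this
            cases c <;> simpa using this
          · rw [← h5 (i + 1) (by omega), auxT_succ, h6]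
        · rintro ⟨h4, h5, h6⟩
          have h7 : x 0 = c := h4 0 (by omega)
          have h8 : nextChange x 0 = k0 + 1 := hchar.2
            ⟨fun t ht => by rw [h4 (t + 1) (by omega), h7], by rw [h5, h7]; cases c <;> simp⟩
          refine ⟨h7, fun i hi => ?_⟩
          rcases i with _ | i
          · rw [auxT_zero, h8, hk]
          · rw [auxT_succ, h8, h6 i (by omega)]
      rw [h3, h2, h1, hpar0]
      simp only [hpar1]
      have h9 : auxPr p (!c) = 1 - auxPr p c := by cases c <;> simp [auxPr]
      rw [h9, ENNReal.ofReal_mul (pow_nonneg (hpr c) _), ENNReal.ofReal_pow (hpr c)]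
      ring

theorem aux_law (γ : Bool → Measure ℕ) [∀ b, IsProbabilityMeasure (γ b)] (h0 : ∀ b, γ b {0} = 0)
    (h1 : ∀ b t, γ b {t + 1} = ENNReal.ofReal (auxPr p b ^ t * (1 - auxPr p b))) (c : Bool) :
    (μ.restrict {x | x 0 = c}).map auxT = ENNReal.ofReal (auxPr p c) • auxNu γ c := by
  apply aux_ext
  intro n w
  have hm : MeasurableSet {x : ℕ → ℕ | ∀ i < n, x i = w i} := by
    have : {x : ℕ → ℕ | ∀ i < n, x i = w i} = ⋂ i, ⋂ (_ : i < n), (fun x => x i) ⁻¹' {w i} := by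
      ext; simp
    rw [this]
    exact MeasurableSet.iInter fun i => MeasurableSet.iInter fun _ =>
      (measurable_pi_apply i) (measurableSet_singleton _)
  rw [Measure.map_apply auxT_meas hm, Measure.restrict_apply (auxT_meas hm),
      Measure.smul_apply, smul_eq_mul]
  have h2 := auxNu_finset γ c (Finset.range n) w
  simp only [Finset.mem_range] at h2
  rw [h2, ← aux_law_cyl p hp0 hp1 μ hμ γ h0 h1]
  congr 1
  ext x
  simp [and_comm]

end law

/-- Example `exbern`: for the Bernoulli measure (`μ(a) = p`,
`μ(b) = 1-p`, `0 < p < 1`), for `μ ⊗ μ`-a.e. `(x,y)`,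
`lim_n M^RLE_n(x,y)/log n = 4/log((1+p)(2-p)/(p(1-p)))`. -/
theorem stmt13 (p : ℝ) (hp0 : 0 < p) (hp1 : p < 1)
    (μ : Measure (ℕ → Bool)) [IsProbabilityMeasure μ]
    (hμ : ∀ (n : ℕ) (w : Fin n → Bool),
      μ {x | ∀ i : Fin n, x i = w i} =
        ENNReal.ofReal (∏ i : Fin n, if w i then p else 1 - p)) :
    ∀ᵐ z ∂(μ.prod μ),
      Tendsto (fun n : ℕ => (MRLE z.1 z.2 n : ℝ) / Real.log n) atTop
        (𝓝 (4 / Real.log ((1 + p) * (2 - p) / (p * (1 - p))))) := by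
  have hpr0 : ∀ b, 0 < auxPr p b := by intro b; cases b <;> simp [auxPr] <;> linarith
  have hpr1 : ∀ b, auxPr p b < 1 := by intro b; cases b <;> simp [auxPr] <;> linarith
  choose γ hγ h0 h1 hR using fun b => aux_exists_geo (auxPr p b) (hpr0 b) (hpr1 b)
  set Y : ℝ := (1 + p) * (2 - p) / (p * (1 - p)) with hY
  have hq : 0 < 1 - p := by linarith
  have hY1 : 1 < Y := by
    rw [hY, one_lt_div (by positivity)]; nlinarith
  have hh : 0 < Real.log Y := Real.log_pos hY1
  have hRR : (∑' t, γ true {t} * γ true {t}) * (∑' t, γ false {t} * γ false {t}) =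
      ENNReal.ofReal (Real.exp (-Real.log Y)) := by
    rw [hR, hR, ← ENNReal.ofReal_mul (div_nonneg (by linarith [hpr1 true]) (by linarith [hpr0 true])),
      Real.exp_neg, Real.exp_log (by linarith)]
    congr 1
    have h2p : 0 < 2 - p := by linarith
    have h3 : 1 + (1 - p) = 2 - p := by ring
    simp only [auxPr, if_true, Bool.false_eq_true, if_false, h3, hY]
    field_simp
    ring
  have main : ∀ c d : Bool, ∀ᵐ z ∂(μ.prod μ), z.1 0 = c → z.2 0 = d →
      Tendsto (fun n : ℕ => (matchLen (auxEnc c (auxT z.1)) (auxEnc d (auxT z.2)) n : ℝ) / Real.log n)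
        atTop (𝓝 (4 / Real.log Y)) := by
    intro c d
    have h2 := aux_lim_nu γ c d (Real.log Y) hh hRR
    have h3 : ∀ᵐ z ∂(((μ.restrict {x | x 0 = c}).map auxT).prod ((μ.restrict {x | x 0 = d}).map auxT)),
        Tendsto (fun n : ℕ => (matchLen (auxEnc c z.1) (auxEnc d z.2) n : ℝ) / Real.log n) atTop
        (𝓝 (4 / Real.log Y)) := by
      rw [aux_law p hp0 hp1 μ hμ γ h0 h1, aux_law p hp0 hp1 μ hμ γ h0 h1]
      have hac : (ENNReal.ofReal (auxPr p c) • auxNu γ c).prod (ENNReal.ofReal (auxPr p d) • auxNu γ d) ≪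
          (auxNu γ c).prod (auxNu γ d) :=
        Measure.AbsolutelyContinuous.prod Measure.smul_absolutelyContinuous
          Measure.smul_absolutelyContinuous
      exact hac.ae_le h2
    rw [Measure.map_prod_map _ _ auxT_meas auxT_meas, Measure.prod_restrict] at h3
    have h4 := ae_of_ae_map (auxT_meas.prodMap auxT_meas).aemeasurable h3
    rw [ae_restrict_iff' ((aux_meas0 c).prod (aux_meas0 d))] at h4
    filter_upwards [h4] with z hz hc hd
    exact hz ⟨hc, hd⟩
  have hg := aux_good p hp0 hp1 μ hμ
  have hg1 : ∀ᵐ z ∂(μ.prod μ), ∀ i, ∃ j, z.1 (i + j + 1) ≠ z.1 i :=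
    Measure.quasiMeasurePreserving_fst.ae hg
  have hg2 : ∀ᵐ z ∂(μ.prod μ), ∀ i, ∃ j, z.2 (i + j + 1) ≠ z.2 i :=
    Measure.quasiMeasurePreserving_snd.ae hg
  have main' := ae_all_iff.2 fun c => ae_all_iff.2 fun d => main c d
  filter_upwards [main', hg1, hg2] with z hz hz1 hz2
  have := hz _ _ rfl rfl
  rw [← aux_rle _ hz1, ← aux_rle _ hz2] at this
  exact this
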